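/- Bisimulation-invariance is preserved by action modalities: let A = (Σ, E, PRE) be an event model whose preconditions Pre_{α_0}, …, Pre_{α_{n−1}} are all bisimulation-invariant. If a formula φ is bisimulation-invariant, then for every event α ∈ Σ the formula ⟨α⟩φ is bisimulation-invariant. -/

import Mathlib

/-- A relational model over a set of worlds `W`. -/
structure Model (W : Type) where
  rel : W → W → Prop
  val : ℕ → Set W

/-- Change the valuation of the proposition letter `p` to `X`. -/
def Model.update {W : Type} (M : Model W) (p : ℕ) (X : Set W) : Model W :=
  ⟨M.rel, fun q => if q = p then X else M.val q⟩

/-- Restriction (relativisation) of a model to a subset of its domain. -/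
def Model.restrict {W : Type} (M : Model W) (A : Set W) : Model A :=
  ⟨fun a b => M.rel a.1 b.1, fun p => {a | a.1 ∈ M.val p}⟩

/-- The language `L∃U`: propositionally quantified modal logic with the global modality. -/
inductive Form : Type where
  | atom : ℕ → Form
  | neg : Form → Form
  | and : Form → Form → Form
  | box : Form → Form
  | ex : ℕ → Form → Form
  | uni : Form → Form

/-- Satisfaction for `L∃U`. -/
def Sat {W : Type} : Model W → W → Form → Prop
  | M, w, .atom p => w ∈ M.val p
  | M, w, .neg φ => ¬ Sat M w φ
  | M, w, .and φ ψ => Sat M w φ ∧ Sat M w ψ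
  | M, w, .box φ => ∀ v, M.rel w v → Sat M v φ
  | M, w, .ex p φ => ∃ X : Set W, Sat (M.update p X) w φ
  | M, w, .uni φ => ∀ v, Sat M v φ

/-- Material implication, `φ ⊃ ψ`. -/
def Form.imp (φ ψ : Form) : Form := .neg (.and φ (.neg ψ))

/-- The proposition letter `p` occurs in a formula. -/
def Form.Occurs (p : ℕ) : Form → Prop
  | .atom q => q = p
  | .neg φ => φ.Occurs p
  | .and φ ψ => φ.Occurs p ∨ ψ.Occurs p
  | .box φ => φ.Occurs p
  | .ex q φ => q = p ∨ φ.Occurs p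
  | .uni φ => φ.Occurs p

/-- The formula contains no global modality `U` (i.e. is in `L∃`). -/
def Form.UFree : Form → Prop
  | .atom _ => True
  | .neg φ => φ.UFree
  | .and φ ψ => φ.UFree ∧ ψ.UFree
  | .box φ => φ.UFree
  | .ex _ φ => φ.UFree
  | .uni _ => False

/-- Semantics of the dynamic relativisation (public announcement) modality `⟨!A⟩φ`. -/
def SatRel {W : Type} (M : Model W) (w : W) (A φ : Form) : Prop :=
  ∃ h : w ∈ {v | Sat M v A}, Sat (M.restrict {v | Sat M v A}) ⟨w, h⟩ φ

/-- An event model with `n` events `α_0, …, α_{n-1}`, preconditions in `L∃U`. -/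
structure EventModel (n : ℕ) where
  E : Fin n → Fin n → Prop
  pre : Fin n → Form

/-- The domain of the product update `M ⊗ A`. -/
def prodDomain {W : Type} (M : Model W) {n : ℕ} (A : EventModel n) : Set (W × Fin n) :=
  {x | Sat M x.1 (A.pre x.2)}

/-- The product update `M ⊗ A`. -/
def prodModel {W : Type} (M : Model W) {n : ℕ} (A : EventModel n) :
    Model (prodDomain M A) :=
  ⟨fun x y => M.rel x.1.1 y.1.1 ∧ A.E x.1.2 y.1.2, fun p => {x | x.1.1 ∈ M.val p}⟩

/-- Semantics of the action modality `⟨α⟩φ` for `φ ∈ L∃U`. -/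
def SatAct {W : Type} {n : ℕ} (M : Model W) (A : EventModel n) (α : Fin n) (w : W)
    (φ : Form) : Prop :=
  ∃ h : (w, α) ∈ prodDomain M A, Sat (prodModel M A) ⟨(w, α), h⟩ φ

/-- The set of sentences `S∃Uj`: `L∃U` plus action nominals `j_i`. -/
inductive FormJ (n : ℕ) : Type where
  | atom : ℕ → FormJ n
  | nom : Fin n → FormJ n
  | neg : FormJ n → FormJ n
  | and : FormJ n → FormJ n → FormJ n
  | box : FormJ n → FormJ n
  | ex : ℕ → FormJ n → FormJ n
  | uni : FormJ n → FormJ n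

/-- Satisfaction for `S∃Uj`, relative to a labelling of worlds by events
(in a product model `M ⊗ A` the label of `(ω, α)` is `α`). -/
def SatJ {n : ℕ} {V : Type} (lab : V → Fin n) : Model V → V → FormJ n → Prop
  | M, w, .atom p => w ∈ M.val p
  | _, w, .nom i => lab w = i
  | M, w, .neg φ => ¬ SatJ lab M w φ
  | M, w, .and φ ψ => SatJ lab M w φ ∧ SatJ lab M w ψ
  | M, w, .box φ => ∀ v, M.rel w v → SatJ lab M v φ
  | M, w, .ex p φ => ∃ X : Set V, SatJ lab (M.update p X) w φ
  | M, w, .uni φ => ∀ v, SatJ lab M v φ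

/-- Semantics of the action modality `⟨α⟩ψ` applied to a sentence `ψ ∈ S∃Uj`:
`M, w ⊨ ⟨α⟩ψ` iff `M, w ⊨ Pre_α` and `M ⊗ A, (w, α) ⊨ ψ`. -/
def SatActJ {W : Type} {n : ℕ} (M : Model W) (A : EventModel n) (α : Fin n) (w : W)
    (ψ : FormJ n) : Prop :=
  ∃ h : (w, α) ∈ prodDomain M A,
    SatJ (fun x : prodDomain M A => x.1.2) (prodModel M A) ⟨(w, α), h⟩ ψ

/-- The proposition letter `p` occurs in a sentence of `S∃Uj`. -/
def FormJ.Occurs {n : ℕ} (p : ℕ) : FormJ n → Prop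
  | .atom q => q = p
  | .nom _ => False
  | .neg φ => φ.Occurs p
  | .and φ ψ => φ.Occurs p ∨ ψ.Occurs p
  | .box φ => φ.Occurs p
  | .ex q φ => q = p ∨ φ.Occurs p
  | .uni φ => φ.Occurs p

/-- Substitution `φ(σ)` of the sentence `σ` for the proposition letter `p` in `φ`. -/
def FormJ.subst {n : ℕ} (p : ℕ) (σ : FormJ n) : FormJ n → FormJ n
  | .atom q => if q = p then σ else .atom q
  | .nom i => .nom i
  | .neg φ => .neg (FormJ.subst p σ φ)
  | .and φ ψ => .and (FormJ.subst p σ φ) (FormJ.subst p σ ψ)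
  | .box φ => .box (FormJ.subst p σ φ)
  | .ex q φ => if q = p then .ex q φ else .ex q (FormJ.subst p σ φ)
  | .uni φ => .uni (FormJ.subst p σ φ)

/-- Disjunction, defined from `¬` and `∧`. -/
def FormJ.or {n : ℕ} (φ ψ : FormJ n) : FormJ n := .neg (.and (.neg φ) (.neg ψ))

/-- Finite disjunction `⋁`. -/
def FormJ.bigOr {n : ℕ} : List (FormJ n) → FormJ n
  | [] => .and (.atom 0) (.neg (.atom 0))
  | [φ] => φ
  | φ :: ψ :: rest => φ.or (FormJ.bigOr (ψ :: rest))

/-- Simultaneous update of the valuation of the (distinct) letters `ps i` to `X i`. -/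
def Model.updateMany {W : Type} (M : Model W) {n : ℕ} (ps : Fin n → ℕ)
    (X : Fin n → Set W) : Model W :=
  ⟨M.rel, fun q => {w | (∃ i, ps i = q ∧ w ∈ X i) ∨ ((∀ i, ps i ≠ q) ∧ w ∈ M.val q)}⟩

/-- A concrete numerical encoding of `L∃U` formulas. -/
def Form.toNat : Form → ℕ
  | .atom p => Nat.pair 0 p
  | .neg φ => Nat.pair 1 φ.toNat
  | .and φ ψ => Nat.pair 2 (Nat.pair φ.toNat ψ.toNat)
  | .box φ => Nat.pair 3 φ.toNat
  | .ex p φ => Nat.pair 4 (Nat.pair p φ.toNat)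
  | .uni φ => Nat.pair 5 φ.toNat

/-- The language `L∃Uα`: `L∃U` with action modalities `⟨α⟩` for events `α` of an event model. -/
inductive FormA (n : ℕ) : Type where
  | atom : ℕ → FormA n
  | neg : FormA n → FormA n
  | and : FormA n → FormA n → FormA n
  | box : FormA n → FormA n
  | ex : ℕ → FormA n → FormA n
  | uni : FormA n → FormA n
  | act : Fin n → FormA n → FormA n

/-- Satisfaction for `L∃Uα`, relative to a fixed event model `A`. -/
def SatA {n : ℕ} (A : EventModel n) : (W : Type) → Model W → W → FormA n → Prop
  | _, M, w, .atom p => w ∈ M.val p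
  | W, M, w, .neg φ => ¬ SatA A W M w φ
  | W, M, w, .and φ ψ => SatA A W M w φ ∧ SatA A W M w ψ
  | W, M, w, .box φ => ∀ v, M.rel w v → SatA A W M v φ
  | W, M, w, .ex p φ => ∃ X : Set W, SatA A W (M.update p X) w φ
  | W, M, w, .uni φ => ∀ v, SatA A W M v φ
  | _, M, w, .act β φ => ∃ h : (w, β) ∈ prodDomain M A,
      SatA A (prodDomain M A) (prodModel M A) ⟨(w, β), h⟩ φ

/-- The set of points reachable from `ω` in at most `k` steps along `R`. -/
def reachWithin {W : Type} (M : Model W) (ω : W) : ℕ → Set W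
  | 0 => {ω}
  | k + 1 => reachWithin M ω k ∪ {v | ∃ u ∈ reachWithin M ω k, M.rel u v}

theorem mem_reachWithin_self {W : Type} (M : Model W) (ω : W) (k : ℕ) :
    ω ∈ reachWithin M ω k := by
  induction k with
  | zero => exact rfl
  | succ k ih => exact Or.inl ih

/-- `M^k_ω`: the submodel of `M` generated by going at most `k` steps along `R` from `ω`. -/
def Model.genSub {W : Type} (M : Model W) (ω : W) (k : ℕ) : Model (reachWithin M ω k) :=
  M.restrict (reachWithin M ω k)

/-- `φ ∈ L∃U` has degree `k`. -/
def HasDegreeForm (φ : Form) (k : ℕ) : Prop :=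
  ∀ (W : Type) (M : Model W) (ω : W),
    Sat M ω φ ↔ Sat (M.genSub ω k) ⟨ω, mem_reachWithin_self M ω k⟩ φ

/-- `φ ∈ L∃Uα` has degree `k`. -/
def HasDegreeA {n : ℕ} (A : EventModel n) (φ : FormA n) (k : ℕ) : Prop :=
  ∀ (W : Type) (M : Model W) (ω : W),
    SatA A W M ω φ ↔
      SatA A (reachWithin M ω k) (M.genSub ω k) ⟨ω, mem_reachWithin_self M ω k⟩ φ

/-- `deg(φ)` for `φ ∈ L∃U` (the least degree; `sInf ∅ = 0` by convention). -/
noncomputable def degForm (φ : Form) : ℕ := sInf {k | HasDegreeForm φ k}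

/-- `deg(φ)` for `φ ∈ L∃Uα`. -/
noncomputable def degA {n : ℕ} (A : EventModel n) (φ : FormA n) : ℕ :=
  sInf {k | HasDegreeA A φ k}

/-- `Z` is a bisimulation between `M` and `M'`. -/
def IsBisim {W W' : Type} (M : Model W) (M' : Model W') (Z : W → W' → Prop) : Prop :=
  ∀ s t, Z s t →
    (∀ p, s ∈ M.val p ↔ t ∈ M'.val p) ∧
    (∀ s₁, M.rel s s₁ → ∃ t₁, M'.rel t t₁ ∧ Z s₁ t₁) ∧
    (∀ t₁, M'.rel t t₁ → ∃ s₁, M.rel s s₁ ∧ Z s₁ t₁)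

/-- `φ ∈ L∃U` is bisimulation-invariant. -/
def BisimInvariant (φ : Form) : Prop :=
  ∀ (W W' : Type) (M : Model W) (M' : Model W') (Z : W → W' → Prop),
    IsBisim M M' Z → ∀ w w', Z w w' → (Sat M w φ ↔ Sat M' w' φ)

/-- The modal fixpoint language `L_μ` (with greatest-fixpoint binders `ν`). -/
inductive Formμ : Type where
  | atom : ℕ → Formμ
  | neg : Formμ → Formμ
  | and : Formμ → Formμ → Formμ
  | box : Formμ → Formμ
  | nu : ℕ → Formμ → Formμ

mutual
/-- All occurrences of `p` are under an even number of negations. -/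
def PosIn (p : ℕ) : Formμ → Prop
  | .atom _ => True
  | .neg φ => NegIn p φ
  | .and φ ψ => PosIn p φ ∧ PosIn p ψ
  | .box φ => PosIn p φ
  | .nu q φ => q = p ∨ PosIn p φ

/-- All occurrences of `p` are under an odd number of negations. -/
def NegIn (p : ℕ) : Formμ → Prop
  | .atom q => q ≠ p
  | .neg φ => PosIn p φ
  | .and φ ψ => NegIn p φ ∧ NegIn p ψ
  | .box φ => NegIn p φ
  | .nu q φ => q = p ∨ NegIn p φ
end

/-- Well-formedness for `L_μ`: in each `νp.φ`, `φ` is positive in `p`. -/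
def WFμ : Formμ → Prop
  | .atom _ => True
  | .neg φ => WFμ φ
  | .and φ ψ => WFμ φ ∧ WFμ ψ
  | .box φ => WFμ φ
  | .nu q φ => PosIn q φ ∧ WFμ φ

/-- Satisfaction for `L_μ`: `⟦νp.φ⟧ = ⋃ {X | ∀ ω ∈ X, M[p ↦ X], ω ⊨ φ}`. -/
def Satμ {W : Type} : Model W → W → Formμ → Prop
  | M, w, .atom p => w ∈ M.val p
  | M, w, .neg φ => ¬ Satμ M w φ
  | M, w, .and φ ψ => Satμ M w φ ∧ Satμ M w ψ
  | M, w, .box φ => ∀ v, M.rel w v → Satμ M v φ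
  | M, w, .nu q φ => w ∈ ⋃₀ {X : Set W | ∀ v ∈ X, Satμ (M.update q X) v φ}

/-- An event model with preconditions in `L_μ`. -/
structure EventModelμ (n : ℕ) where
  E : Fin n → Fin n → Prop
  pre : Fin n → Formμ

/-- The domain of the product update `M ⊗ A` for `L_μ` event models. -/
def prodDomainμ {W : Type} (M : Model W) {n : ℕ} (A : EventModelμ n) : Set (W × Fin n) :=
  {x | Satμ M x.1 (A.pre x.2)}

/-- The product update `M ⊗ A` for `L_μ` event models. -/
def prodModelμ {W : Type} (M : Model W) {n : ℕ} (A : EventModelμ n) :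
    Model (prodDomainμ M A) :=
  ⟨fun x y => M.rel x.1.1 y.1.1 ∧ A.E x.1.2 y.1.2, fun p => {x | x.1.1 ∈ M.val p}⟩

/-- A bisimulation between `M` and `M'` lifts, event by event, to one between the product
updates, provided the preconditions are bisimulation-invariant. -/
theorem IsBisim.prodModel {n : ℕ} {A : EventModel n} (hA : ∀ i, BisimInvariant (A.pre i))
    {W W' : Type} {M : Model W} {M' : Model W'} {Z : W → W' → Prop} (hZ : IsBisim M M' Z) :
    IsBisim (prodModel M A) (prodModel M' A)
      (fun x y => Z x.1.1 y.1.1 ∧ x.1.2 = y.1.2) := by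
  rintro ⟨⟨s, i⟩, hs⟩ ⟨⟨t, j⟩, ht⟩ ⟨hst, hij⟩
  obtain rfl : i = j := hij
  obtain ⟨atoms, forth, back⟩ := hZ s t hst
  refine ⟨atoms, ?_, ?_⟩
  · rintro ⟨⟨s₁, k⟩, hs₁⟩ ⟨hR, hE⟩
    obtain ⟨t₁, hR', hst₁⟩ := forth s₁ hR
    exact ⟨⟨(t₁, k), (hA k W W' M M' Z hZ s₁ t₁ hst₁).1 hs₁⟩, ⟨hR', hE⟩, hst₁, rfl⟩
  · rintro ⟨⟨t₁, k⟩, ht₁⟩ ⟨hR, hE⟩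
    obtain ⟨s₁, hR', hst₁⟩ := back t₁ hR
    exact ⟨⟨(s₁, k), (hA k W W' M M' Z hZ s₁ t₁ hst₁).2 ht₁⟩, ⟨hR', hE⟩, hst₁, rfl⟩

/-- Bisimulation-invariance is preserved by action modalities: if all the
preconditions and `φ` are bisimulation-invariant then so is `⟨α⟩φ`: whenever `Z` is a
bisimulation relating `w` to `w'`, `M, w ⊨ ⟨α⟩φ` iff `M', w' ⊨ ⟨α⟩φ`. -/
theorem stmt11 (n : ℕ) (hn : 0 < n) (A : EventModel n)
    (hA : ∀ i, BisimInvariant (A.pre i))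
    (φ : Form) (hφ : BisimInvariant φ) (α : Fin n) :
    ∀ (W W' : Type) (M : Model W) (M' : Model W') (Z : W → W' → Prop),
      IsBisim M M' Z → ∀ w w', Z w w' →
        (SatAct M A α w φ ↔ SatAct M' A α w' φ) := by
  intro W W' M M' Z hZ w w' hw
  have hpre := hA α W W' M M' Z hZ w w' hw
  have hsat (h : (w, α) ∈ prodDomain M A) (h' : (w', α) ∈ prodDomain M' A) :
      Sat (prodModel M A) ⟨(w, α), h⟩ φ ↔ Sat (prodModel M' A) ⟨(w', α), h'⟩ φ :=
    hφ _ _ _ _ _ (hZ.prodModel hA) _ _ ⟨hw, rfl⟩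
  exact ⟨fun ⟨h, hs⟩ => ⟨hpre.1 h, (hsat h _).1 hs⟩, fun ⟨h, hs⟩ => ⟨hpre.2 h, (hsat _ h).2 hs⟩⟩
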